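/- Let R be a commutative ring, let f, g ∈ R[x_1,…,x_n], and let x_k and x_j be two distinct variables. Then the degree of the resultant res(f, g, x_k) in the variable x_j satisfies deg_{x_j}(res(f, g, x_k)) ≤ deg_{x_k}(f)·deg_{x_j}(g) + deg_{x_k}(g)·deg_{x_j}(f). -/

import Mathlib

open MvPolynomial

/-- `f` regarded as a univariate polynomial in the variable `k`,
with coefficients in the polynomial ring in the remaining variables. -/
noncomputable def toUnivar {σ R : Type*} [CommSemiring R] [DecidableEq σ] (k : σ)
    (f : MvPolynomial σ R) : Polynomial (MvPolynomial {j : σ // j ≠ k} R) :=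
  optionEquivLeft R {j : σ // j ≠ k} (rename (Equiv.optionSubtypeNe k).symm f)

/-- The `i`-th coefficient of `f` regarded as a univariate polynomial in `k`,
viewed again as a polynomial in all the variables. -/
noncomputable def coeffWrt {σ R : Type*} [CommSemiring R] [DecidableEq σ] (k : σ)
    (f : MvPolynomial σ R) (i : ℕ) : MvPolynomial σ R :=
  rename Subtype.val ((toUnivar k f).coeff i)

/-- The Sylvester matrix of two univariate polynomials `p` and `q`:
the first `q.natDegree` rows are the shifted coefficient vectors of `p`,
the remaining `p.natDegree` rows are the shifted coefficient vectors of `q`. -/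
noncomputable def sylvesterMatrix {R : Type*} [CommRing R] (p q : Polynomial R) :
    Matrix (Fin (q.natDegree + p.natDegree)) (Fin (q.natDegree + p.natDegree)) R :=
  Matrix.of fun i j =>
    if (i : ℕ) < q.natDegree then
      (if (i : ℕ) ≤ (j : ℕ) ∧ (j : ℕ) ≤ (i : ℕ) + p.natDegree
        then p.coeff (p.natDegree - ((j : ℕ) - (i : ℕ))) else 0)
    else
      (if (i : ℕ) - q.natDegree ≤ (j : ℕ) ∧ (j : ℕ) ≤ ((i : ℕ) - q.natDegree) + q.natDegree
        then q.coeff (q.natDegree - ((j : ℕ) - ((i : ℕ) - q.natDegree))) else 0)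

/-- The resultant of two univariate polynomials: the determinant of their Sylvester matrix. -/
noncomputable def resultant {R : Type*} [CommRing R] (p q : Polynomial R) : R :=
  (sylvesterMatrix p q).det

/-- The resultant of `f` and `g` with respect to the variable `k`: the resultant of `f` and `g`
regarded as univariate polynomials in `k`, viewed again as a polynomial in all the variables. -/
noncomputable def resWrt {σ R : Type*} [CommRing R] [DecidableEq σ] (k : σ)
    (f g : MvPolynomial σ R) : MvPolynomial σ R :=
  rename Subtype.val (resultant (toUnivar k f) (toUnivar k g))


theorem MvPolynomial.degreeOf_det_le {σ R ι : Type*} [CommRing R] [Fintype ι] [DecidableEq ι]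
    (v : σ) (M : Matrix ι ι (MvPolynomial σ R)) (d : ι → ℕ)
    (h : ∀ i j, (M i j).degreeOf v ≤ d i) : M.det.degreeOf v ≤ ∑ i, d i := by
  rw [Matrix.det_apply]
  refine (degreeOf_sum_le _ _ _).trans (Finset.sup_le fun τ _ => ?_)
  have hprod : (∏ i, M (τ i) i).degreeOf v ≤ ∑ i, d i :=
    calc (∏ i, M (τ i) i).degreeOf v ≤ ∑ i, (M (τ i) i).degreeOf v := degreeOf_prod_le _ _ _
      _ ≤ ∑ i, d (τ i) := Finset.sum_le_sum fun i _ => h _ _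
      _ = ∑ i, d i := Equiv.sum_comp τ d
  rcases Int.units_eq_one_or (Equiv.Perm.sign τ) with hs | hs
  · simpa [hs] using hprod
  · simpa [hs, degreeOf_neg] using hprod

theorem MvPolynomial.degreeOf_coeff_optionEquivLeft_le {σ R : Type*} [CommSemiring R]
    (p : MvPolynomial (Option σ) R) (v : σ) (i : ℕ) :
    ((optionEquivLeft R σ p).coeff i).degreeOf v ≤ p.degreeOf (some v) := by
  rw [degreeOf_le_iff]
  intro m hm
  simpa using degreeOf_le_iff.mp (le_refl (p.degreeOf (some v))) _
    ((mem_support_coeff_optionEquivLeft R).mp hm)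

theorem natDegree_toUnivar {σ R : Type*} [CommSemiring R] [DecidableEq σ] (k : σ)
    (f : MvPolynomial σ R) : (toUnivar k f).natDegree = f.degreeOf k :=
  (degreeOf_eq_natDegree k f).symm

theorem degreeOf_coeff_toUnivar_le {σ R : Type*} [CommSemiring R] [DecidableEq σ] (k : σ)
    (f : MvPolynomial σ R) (v : {j : σ // j ≠ k}) (i : ℕ) :
    ((toUnivar k f).coeff i).degreeOf v ≤ f.degreeOf (v : σ) := by
  refine (degreeOf_coeff_optionEquivLeft_le _ v i).trans_eq ?_
  rw [← Equiv.optionSubtypeNe_symm_of_ne v.2,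
    degreeOf_rename_of_injective (Equiv.injective _)]

theorem degreeOf_resultant_le {σ R : Type*} [CommRing R] (v : σ)
    (p q : Polynomial (MvPolynomial σ R)) {a b : ℕ} (hp : ∀ i, (p.coeff i).degreeOf v ≤ a)
    (hq : ∀ i, (q.coeff i).degreeOf v ≤ b) :
    (resultant p q).degreeOf v ≤ p.natDegree * b + q.natDegree * a := by
  refine (degreeOf_det_le v _
    (fun i : Fin (q.natDegree + p.natDegree) => if (i : ℕ) < q.natDegree then a else b)
    ?_).trans_eq ?_
  · intro i j
    simp only [sylvesterMatrix, Matrix.of_apply]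
    split_ifs <;> simp [hp, hq]
  · simp [Fin.sum_univ_add, add_comm]

/-- The degree in `x_j` (`j ≠ k`) of `res(f, g, x_k)` is at most
`deg_{x_k}(f)·deg_{x_j}(g) + deg_{x_k}(g)·deg_{x_j}(f)`. -/
theorem degreeOf_resWrt_le {R : Type*} [CommRing R] {n : ℕ}
    (f g : MvPolynomial (Fin n) R) (k j : Fin n) (hjk : j ≠ k) :
    (resWrt k f g).degreeOf j ≤
      f.degreeOf k * g.degreeOf j + g.degreeOf k * f.degreeOf j := by
  rw [resWrt, ← natDegree_toUnivar k f, ← natDegree_toUnivar k g,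
    show j = Subtype.val (⟨j, hjk⟩ : {j : Fin n // j ≠ k}) from rfl,
    degreeOf_rename_of_injective Subtype.val_injective]
  exact degreeOf_resultant_le _ _ _ (degreeOf_coeff_toUnivar_le k f _)
    (degreeOf_coeff_toUnivar_le k g _)
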